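/- Let r ≥ 2 and let G be an r-graph with at least one edge. Then the function f_G(α) = (λ^(α)(G)/(r!·e(G)))^α is nonincreasing on [1,∞): for all 1 ≤ α ≤ β, (λ^(β)(G)/(r!·e(G)))^β ≤ (λ^(α)(G)/(r!·e(G)))^α. -/

import Mathlib

/-!
Common definitions: `r`-uniform hypergraphs on vertex set `Fin n`, the polyform,
the parameter `λ^(α)`, degrees, properties of `r`-graphs, blow-ups, extremal
numbers and chromatic numbers.
-/

open Finset

/-- An `r`-uniform hypergraph on the vertex set `Fin n`. -/
structure HGraph (r n : ℕ) where
  edges : Finset (Finset (Fin n))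
  uniform : ∀ e ∈ edges, e.card = r

namespace HGraph

/-- The polyform `P_G(x) = r! ∑_{e ∈ E(G)} ∏_{i ∈ e} x_i`. -/
noncomputable def polyform {r n : ℕ} (G : HGraph r n) (x : Fin n → ℝ) : ℝ :=
  (r.factorial : ℝ) * ∑ e ∈ G.edges, ∏ i ∈ e, x i

/-- `λ^(α)(G)`: the maximum of the polyform over the unit sphere of `ℓ^α`. -/
noncomputable def lam {r n : ℕ} (α : ℝ) (G : HGraph r n) : ℝ :=
  sSup {y : ℝ | ∃ x : Fin n → ℝ, (∑ i, |x i| ^ α) = 1 ∧ y = G.polyform x}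

/-- The degree of a vertex: the number of edges containing it. -/
def degree {r n : ℕ} (G : HGraph r n) (v : Fin n) : ℕ :=
  (G.edges.filter (fun e => v ∈ e)).card

/-- Maximum degree `Δ(G)`. -/
def maxDeg {r n : ℕ} (G : HGraph r n) : ℕ :=
  Finset.univ.sup G.degree

/-- Minimum degree `δ(G)`. -/
noncomputable def minDeg {r n : ℕ} (G : HGraph r n) : ℕ :=
  sInf (Set.range G.degree)

/-- `G` is regular if all vertices have equal degrees. -/
def Regular {r n : ℕ} (G : HGraph r n) : Prop :=
  ∀ u v : Fin n, G.degree u = G.degree v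

/-- The induced subgraph of `G` along the embedding `f`. -/
def induce {r n m : ℕ} (G : HGraph r n) (f : Fin m ↪ Fin n) : HGraph r m where
  edges := Finset.univ.filter (fun e : Finset (Fin m) => e.map f ∈ G.edges)
  uniform := by
    intro e he
    rw [Finset.mem_filter] at he
    have h2 := G.uniform _ he.2
    rwa [Finset.card_map] at h2

/-- A property of `r`-graphs: a family closed under isomorphism (relabeling). -/
def IsProperty {r : ℕ} (P : ∀ n, Set (HGraph r n)) : Prop :=
  ∀ n : ℕ, ∀ σ : Equiv.Perm (Fin n), ∀ G ∈ P n, G.induce σ.toEmbedding ∈ P n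

/-- A hereditary property: closed under taking induced subgraphs. -/
def Hereditary {r : ℕ} (P : ∀ n, Set (HGraph r n)) : Prop :=
  ∀ n m : ℕ, ∀ f : Fin m ↪ Fin n, ∀ G ∈ P n, G.induce f ∈ P m

/-- A monotone property: closed under taking subgraphs. -/
def MonotoneProp {r : ℕ} (P : ∀ n, Set (HGraph r n)) : Prop :=
  ∀ n m : ℕ, ∀ f : Fin m ↪ Fin n, ∀ G ∈ P n, ∀ H : HGraph r m,
    (∀ e ∈ H.edges, e.map f ∈ G.edges) → H ∈ P m

/-- `B`, together with the projection `φ : V(B) → V(G)`, is (a copy of) the blow-up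
`G(k 1, …, k n)` of `G`: the fiber over a vertex `i` of `G` has `k i` vertices, and the
edges of `B` are exactly the transversals of the classes corresponding to edges of `G`. -/
def IsBlowup {r n N : ℕ} (G : HGraph r n) (k : Fin n → ℕ)
    (B : HGraph r N) (φ : Fin N → Fin n) : Prop :=
  (∀ i : Fin n, (Finset.univ.filter (fun v => φ v = i)).card = k i) ∧
  ∀ s : Finset (Fin N), s ∈ B.edges ↔ (Set.InjOn φ ↑s ∧ s.image φ ∈ G.edges)

/-- A multiplicative property: contains all blow-ups of all of its members. -/
def MultiplicativeProp {r : ℕ} (P : ∀ n, Set (HGraph r n)) : Prop :=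
  ∀ n : ℕ, ∀ G ∈ P n, ∀ k : Fin n → ℕ, (∀ i, 0 < k i) →
    ∀ N : ℕ, ∀ B : HGraph r N, ∀ φ : Fin N → Fin n, IsBlowup G k B φ → B ∈ P N

/-- The extremal number `ex(P, n)`: the maximum number of edges of a member of `P`
of order `n`. -/
noncomputable def exP {r : ℕ} (P : ∀ n, Set (HGraph r n)) (n : ℕ) : ℕ :=
  sSup {m : ℕ | ∃ G ∈ P n, G.edges.card = m}

/-- `λ^(α)(P, n)`: the maximum of `λ^(α)(G)` over members `G` of `P` of order `n`. -/
noncomputable def lamP {r : ℕ} (α : ℝ) (P : ∀ n, Set (HGraph r n)) (n : ℕ) : ℝ :=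
  sSup {y : ℝ | ∃ G ∈ P n, y = lam α G}

/-- The chromatic number: the least `k` such that the vertices can be `k`-colored
with no monochromatic edge (i.e. partitioned into `k` edgeless sets). -/
noncomputable def chrom {r n : ℕ} (G : HGraph r n) : ℕ :=
  sInf {k : ℕ | ∃ c : Fin n → Fin k, ∀ e ∈ G.edges, ¬ ∀ u ∈ e, ∀ w ∈ e, c u = c w}

/-- The weak chromatic number: the least `k` such that the vertices can be `k`-colored
with every edge getting `r` distinct colors (every class meets every edge in ≤ 1 vertex). -/
noncomputable def wchrom {r n : ℕ} (G : HGraph r n) : ℕ :=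
  sInf {k : ℕ | ∃ c : Fin n → Fin k, ∀ e ∈ G.edges, Set.InjOn c ↑e}

/-- `Mon(H)`: the (monotone, hereditary) property of all `r`-graphs containing no
subgraph isomorphic to `H`. -/
def MonP {r h : ℕ} (H : HGraph r h) : ∀ n, Set (HGraph r n) :=
  fun n => {G | ¬ ∃ f : Fin h ↪ Fin n, ∀ e ∈ H.edges, e.map f ∈ G.edges}

end HGraph

open HGraph

namespace HGraph

theorem polyform_le_polyform_abs {r n : ℕ} (G : HGraph r n) (x : Fin n → ℝ) :
    G.polyform x ≤ G.polyform fun i => |x i| := by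
  refine mul_le_mul_of_nonneg_left (Finset.sum_le_sum fun e _ => ?_) (Nat.cast_nonneg _)
  rw [← Finset.abs_prod]
  exact le_abs_self _

theorem polyform_nonneg {r n : ℕ} (G : HGraph r n) {x : Fin n → ℝ} (hx : ∀ i, 0 ≤ x i) :
    0 ≤ G.polyform x :=
  mul_nonneg (Nat.cast_nonneg _)
    (Finset.sum_nonneg fun _ _ => Finset.prod_nonneg fun i _ => hx i)

theorem abs_le_one_of_sum_rpow_eq_one {n : ℕ} {α : ℝ} (hα : 0 < α) {x : Fin n → ℝ}
    (hx : ∑ i, |x i| ^ α = 1) (i : Fin n) : |x i| ≤ 1 := by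
  have h : |x i| ^ α ≤ 1 := hx ▸ Finset.single_le_sum (f := fun i => |x i| ^ α)
    (fun j _ => Real.rpow_nonneg (abs_nonneg _) α) (Finset.mem_univ i)
  by_contra! h1
  exact absurd h (not_le.mpr (Real.one_lt_rpow h1 hα))

theorem bddAbove_polyform {r n : ℕ} (G : HGraph r n) {α : ℝ} (hα : 0 < α) :
    BddAbove {y : ℝ | ∃ x : Fin n → ℝ, (∑ i, |x i| ^ α) = 1 ∧ y = G.polyform x} := by
  refine ⟨(r.factorial : ℝ) * ∑ e ∈ G.edges, 1, ?_⟩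
  rintro y ⟨x, hx, rfl⟩
  refine (G.polyform_le_polyform_abs x).trans ?_
  unfold polyform
  gcongr with e he
  exact Finset.prod_le_one (fun i _ => abs_nonneg _)
    fun i _ => abs_le_one_of_sum_rpow_eq_one hα hx i

theorem polyform_le_lam {r n : ℕ} (G : HGraph r n) {α : ℝ} (hα : 0 < α) {x : Fin n → ℝ}
    (hx : ∑ i, |x i| ^ α = 1) : G.polyform x ≤ lam α G :=
  le_csSup (G.bddAbove_polyform hα) ⟨x, hx, rfl⟩

theorem lam_nonneg {r n : ℕ} (G : HGraph r n) {α : ℝ} (hα : 0 < α) : 0 ≤ lam α G := by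
  rcases isEmpty_or_nonempty (Fin n) with hn | ⟨⟨i⟩⟩
  · refine Real.sSup_nonneg ?_
    rintro y ⟨x, -, rfl⟩
    exact G.polyform_nonneg fun i => hn.elim i
  · have hx : ∑ j, |(Pi.single i 1 : Fin n → ℝ) j| ^ α = 1 := by
      rw [Finset.sum_eq_single i]
      · simp
      · intro j _ hj
        simp [Pi.single_eq_of_ne hj, Real.zero_rpow hα.ne']
      · simp
    refine le_trans (G.polyform_nonneg fun j => ?_) (G.polyform_le_lam hα hx)
    by_cases h : j = i <;> simp [h]

/-- The power mean inequality for the edge monomials of an `r`-graph. -/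
theorem polyform_div_rpow_le {r n : ℕ} (G : HGraph r n) (hG : G.edges.Nonempty) {p : ℝ}
    (hp : 1 ≤ p) {x : Fin n → ℝ} (hx : ∀ i, 0 ≤ x i) :
    (G.polyform x / ((r.factorial : ℝ) * G.edges.card)) ^ p ≤
      G.polyform (fun i => x i ^ p) / ((r.factorial : ℝ) * G.edges.card) := by
  have hr : (r.factorial : ℝ) ≠ 0 := by positivity
  have hm : (G.edges.card : ℝ) ≠ 0 := by exact_mod_cast hG.card_ne_zero
  have key := Real.rpow_arith_mean_le_arith_mean_rpow G.edges
    (fun _ => (G.edges.card : ℝ)⁻¹) (fun e => ∏ i ∈ e, x i)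
    (fun _ _ => by positivity) (by simp [hm])
    (fun e _ => Finset.prod_nonneg fun i _ => hx i) hp
  simp only [← Finset.mul_sum, ← Real.finsetProd_rpow _ _ (fun i _ => hx i)] at key
  unfold polyform
  rwa [mul_div_mul_left _ _ hr, mul_div_mul_left _ _ hr, div_eq_inv_mul, div_eq_inv_mul]

end HGraph

/-- Proposition 6: for an `r`-graph `G` with at least one edge, the
function `f_G(α) = (λ^(α)(G)/(r!·e(G)))^α` is nonincreasing on `[1, ∞)`. -/
theorem stmt5 {r n : ℕ} (hr : 2 ≤ r) (G : HGraph r n) (hG : G.edges.Nonempty)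
    (α β : ℝ) (hα : 1 ≤ α) (hαβ : α ≤ β) :
    (lam β G / ((r.factorial : ℝ) * G.edges.card)) ^ β ≤
      (lam α G / ((r.factorial : ℝ) * G.edges.card)) ^ α := by
  have hα0 : 0 < α := by linarith
  have hβ0 : 0 < β := by linarith
  set c : ℝ := (r.factorial : ℝ) * G.edges.card
  have hc : 0 < c := by
    have := hG.card_pos
    positivity
  have hB : 0 ≤ lam α G / c := div_nonneg (G.lam_nonneg hα0) hc.le
  have hp : 1 ≤ β / α := (one_le_div hα0).mpr hαβ
  have hle : lam β G ≤ (lam α G / c) ^ (α / β) * c := by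
    refine Real.sSup_le ?_ (by positivity)
    rintro y ⟨x, hx, rfl⟩
    refine (G.polyform_le_polyform_abs x).trans ((div_le_iff₀ hc).mp ?_)
    have hnn : 0 ≤ G.polyform (fun i => |x i|) / c :=
      div_nonneg (G.polyform_nonneg fun i => abs_nonneg _) hc.le
    have hy : ∑ i, |(|x i| ^ (β / α))| ^ α = 1 := by
      rw [← hx]
      refine Finset.sum_congr rfl fun i _ => ?_
      rw [abs_of_nonneg (by positivity), ← Real.rpow_mul (abs_nonneg _),
        div_mul_cancel₀ _ hα0.ne']
    have h : (G.polyform (fun i => |x i|) / c) ^ (β / α) ≤ lam α G / c :=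
      (G.polyform_div_rpow_le hG hp fun i => abs_nonneg _).trans
        (div_le_div_of_nonneg_right (G.polyform_le_lam hα0 hy) hc.le)
    rw [← inv_div β α]
    exact (Real.le_rpow_inv_iff_of_pos hnn hB (by positivity)).mpr h
  calc (lam β G / c) ^ β ≤ ((lam α G / c) ^ (α / β)) ^ β :=
        Real.rpow_le_rpow (div_nonneg (G.lam_nonneg hβ0) hc.le)
          ((div_le_iff₀ hc).mpr hle) hβ0.le
    _ = (lam α G / c) ^ α := by
        rw [← Real.rpow_mul hB, div_mul_cancel₀ _ hβ0.ne']
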